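/- arXiv:1409.1168 — 2 statements merged into one kernel-verified Lean document; each statement's English description precedes it below -/
import Mathlib

section
/- The intersections R_a ∩ (R_a + (α² - 1)) and R_a ∩ (R_a + (α - 1)²) are singletons: R_a ∩ (R_a + (α² - 1)) = { -1 } and R_a ∩ (R_a + (α - 1)²) = { -α }. -/
open Complex Filter Topology

noncomputable section

/-- The word `w₁w₂w₃w₄` is lexicographically smaller than the word `(a-1)(a-1)01`. -/
def WordLt (a : ℤ) (w₁ w₂ w₃ w₄ : ℤ) : Prop :=
  w₁ < a - 1 ∨ (w₁ = a - 1 ∧ (w₂ < a - 1 ∨ (w₂ = a - 1 ∧ (w₃ < 0 ∨ (w₃ = 0 ∧ w₄ < 1)))))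

/-- A sequence of integers `(c i)_{i ≥ k}` with `0 ≤ c i ≤ a-1` is admissible if for every
`i ≥ k+3` the word `c i, c (i-1), c (i-2), c (i-3)` is lexicographically smaller
than `(a-1)(a-1)01`. (Values of `c` below index `k` are irrelevant.) -/
def Admissible (a k : ℤ) (c : ℤ → ℤ) : Prop :=
  (∀ i, k ≤ i → 0 ≤ c i ∧ c i ≤ a - 1) ∧
  (∀ i, k + 3 ≤ i → WordLt a (c i) (c (i - 1)) (c (i - 2)) (c (i - 3)))

/-- The Rauzy fractal `R_a = { Σ_{i=2}^∞ c_i α^i : (c_i)_{i≥2} admissible }`. -/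
def Rauzy (a : ℤ) (α : ℂ) : Set ℂ :=
  {z | ∃ c : ℤ → ℤ, Admissible a 2 c ∧
    z = ∑' n : ℕ, (c ((n : ℤ) + 2) : ℂ) * α ^ (n + 2)}

/-- `B_v = R_a ∩ (R_a + v)`. -/
def BSet (a : ℤ) (α : ℂ) (v : ℂ) : Set ℂ :=
  Rauzy a α ∩ ((· + v) '' Rauzy a α)

/-- `B'_{α-1}`: points of `B_{α-1}` admitting an admissible expansion
`z = α - 1 + Σ_{i=3}^∞ c_i α^i` with `c 3 ≠ a-1`. -/
def Bprime (a : ℤ) (α : ℂ) : Set ℂ :=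
  {z | z ∈ BSet a α (α - 1) ∧ ∃ c : ℤ → ℤ, Admissible a 3 c ∧ c 3 ≠ a - 1 ∧
    z = α - 1 + ∑' n : ℕ, (c ((n : ℤ) + 3) : ℂ) * α ^ (n + 3)}

/-- `g_{2k+1}(z) = -1 - k α³ + α³ z`. -/
def gOdd (α : ℂ) (k : ℤ) (z : ℂ) : ℂ := -1 - (k : ℂ) * α ^ 3 + α ^ 3 * z

/-- `g_{2k}(z) = α - 1 + (a-1-k) α³ + α² z`. -/
def gEven (a : ℤ) (α : ℂ) (k : ℤ) (z : ℂ) : ℂ :=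
  α - 1 + ((a : ℂ) - 1 - (k : ℂ)) * α ^ 3 + α ^ 2 * z


lemma root_facts (a : ℤ) (ha : 3 ≤ a) (α : ℂ)
    (hroot : α ^ 3 - (a : ℂ) * α ^ 2 + α - 1 = 0) (hα : α.im ≠ 0) :
    normSq α < 1 ∧ 2 * α.re = (1 - normSq α) * normSq α := by
  have ha' : (3 : ℝ) ≤ a := by exact_mod_cast ha
  have hre := congrArg Complex.re hroot
  have him := congrArg Complex.im hroot
  simp [pow_succ] at hre him
  rw [normSq_apply]
  set x := α.re
  set y := α.im
  have hy : 0 < y ^ 2 := by positivity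
  have h1 : 3 * x ^ 2 - y ^ 2 - 2 * a * x + 1 = 0 := by
    apply mul_left_cancel₀ hα
    linear_combination him
  have h2 : (x * x + y * y) * (a - 2 * x) = 1 := by
    linear_combination hre - x * h1
  set N := x * x + y * y with hN
  have hNpos : 0 < N := by nlinarith [sq_nonneg x]
  -- β = a - 2x
  set β := a - 2 * x with hβ
  have hβpos : 0 < β := by
    by_contra h
    push Not at h
    nlinarith
  have h3 : β * (2 * x) = 1 - N := by
    rw [hβ, hN]; linear_combination -h1
  have h4 : 2 * x = a - β := by rw [hβ]; ring
  constructor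
  · by_contra h
    push Not at h
    have hb1 : β ≤ 1 := by nlinarith
    rw [h4] at h3
    nlinarith
  · have : 2 * x = (N * β) * (2 * x) := by rw [h2]; ring
    rw [this, mul_assoc, h3]; ring

lemma max_bound (a : ℤ) (ha : 3 ≤ a) (M : ℤ) (hM : 2 ≤ M) (R : ℕ → ℤ) (m : ℕ)
    (hb : ∀ n, |R n| ≤ M) (hm : R (m + 3) = M)
    (he : ∀ n, |R n - a * R (n + 1) + R (n + 2) - R (n + 3)| ≤ a - 1) : False := by
  have b0 := abs_le.1 (hb m)
  have b1 := abs_le.1 (hb (m+1))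
  have b2 := abs_le.1 (hb (m+2))
  have b4 := abs_le.1 (hb (m+4))
  have b5 := abs_le.1 (hb (m+5))
  have b6 := abs_le.1 (hb (m+6))
  have b7 := abs_le.1 (hb (m+7))
  have b8 := abs_le.1 (hb (m+8))
  have b9 := abs_le.1 (hb (m+9))
  have e0 := abs_le.1 (he m)
  have e1 := abs_le.1 (he (m+1))
  have e2 := abs_le.1 (he (m+2))
  have e3 := abs_le.1 (he (m+3))
  have e4 := abs_le.1 (he (m+4))
  have e5 := abs_le.1 (he (m+5))
  have e6 := abs_le.1 (he (m+6))
  simp only [Nat.add_assoc, Nat.reduceAdd] at *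
  rw [hm] at e0 e1 e2 e3
  by_cases h6 : 6 ≤ a
  · nlinarith
  · have : a = 3 ∨ a = 4 ∨ a = 5 := by omega
    rcases this with rfl | rfl | rfl
    · by_cases hM3 : 3 ≤ M
      · omega
      · obtain rfl : M = 2 := by omega
        clear hb he hm
        omega
    · clear hb he hm
      omega
    · clear hb he hm
      omega

lemma abs_le_one (a : ℤ) (ha : 3 ≤ a) (R : ℕ → ℤ) (B : ℝ) (hB : ∀ n, |(R n : ℝ)| ≤ B)
    (he : ∀ n, |R n - a * R (n + 1) + R (n + 2) - R (n + 3)| ≤ a - 1)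
    (h0 : |R 0| ≤ 1) (h1 : |R 1| ≤ 1) (h2 : |R 2| ≤ 1) : ∀ n, |R n| ≤ 1 := by
  obtain ⟨M, ⟨n0, hn0⟩, hmax⟩ : ∃ M : ℤ, (∃ n, |R n| = M) ∧ ∀ z : ℤ, (∃ n, |R n| = z) → z ≤ M := by
    apply Int.exists_greatest_of_bdd
    · refine ⟨⌈B⌉, ?_⟩
      rintro z ⟨n, rfl⟩
      have := (hB n).trans (Int.le_ceil B)
      exact_mod_cast this
    · exact ⟨_, 0, rfl⟩
  have hb : ∀ n, |R n| ≤ M := fun n => hmax _ ⟨n, rfl⟩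
  by_cases hM : M ≤ 1
  · exact fun n => (hb n).trans hM
  exfalso
  push Not at hM
  obtain ⟨m, rfl⟩ : ∃ m, n0 = m + 3 := by
    refine ⟨n0 - 3, ?_⟩
    have : n0 ≠ 0 := by rintro rfl; omega
    have : n0 ≠ 1 := by rintro rfl; omega
    have : n0 ≠ 2 := by rintro rfl; omega
    omega
  rcases abs_choice (R (m+3)) with h | h
  · exact max_bound a ha M hM R m hb (by omega) he
  · refine max_bound a ha M hM (fun n => - R n) m (fun n => by simpa using hb n) (by omega) ?_
    intro n
    rw [← abs_neg]
    convert he n using 2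
    ring

/-- The integer sequence of remainders. -/
def rem (a : ℤ) (e : ℕ → ℤ) (x y z : ℤ) : ℕ → ℤ × ℤ × ℤ
  | 0 => (x, y, z)
  | n + 1 =>
    let s := rem a e x y z n
    (s.2.1, s.2.2, s.1 - a * s.2.1 + s.2.2 - e n)

lemma exists_seq (a : ℤ) (e : ℕ → ℤ) (x y z : ℤ) : ∃ R : ℕ → ℤ, R 0 = x ∧ R 1 = y ∧ R 2 = z ∧
    ∀ n, R (n + 3) = R n - a * R (n + 1) + R (n + 2) - e n :=
  ⟨fun n => (rem a e x y z n).1, rfl, rfl, rfl, fun _ => rfl⟩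

lemma summable_bdd (α : ℂ) (h : ‖α‖ < 1) (e : ℕ → ℤ) (C : ℝ) (he : ∀ n, |(e n : ℝ)| ≤ C) :
    Summable (fun n => (e n : ℂ) * α ^ n) := by
  refine Summable.of_norm_bounded (g := fun n => C * ‖α‖ ^ n)
    ((summable_geometric_of_lt_one (norm_nonneg _) h).mul_left C) ?_
  intro n
  rw [norm_mul, norm_pow]
  gcongr
  simpa using he n

lemma norm_tsum_bdd (α : ℂ) (h : ‖α‖ < 1) (e : ℕ → ℤ) (C : ℝ) (he : ∀ n, |(e n : ℝ)| ≤ C) :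
    ‖∑' n, (e n : ℂ) * α ^ n‖ ≤ C * (1 - ‖α‖)⁻¹ := by
  refine tsum_of_norm_bounded (f := fun n => (e n : ℂ) * α ^ n) (g := fun n => C * ‖α‖ ^ n)
    ((hasSum_geometric_of_lt_one (norm_nonneg _) h).mul_left C) ?_
  intro n
  rw [norm_mul, norm_pow]
  gcongr
  simpa using he n

lemma norm_lt (a : ℤ) (ha : 3 ≤ a) (α : ℂ)
    (hroot : α ^ 3 - (a : ℂ) * α ^ 2 + α - 1 = 0) (hα : α.im ≠ 0) : ‖α‖ < 1 := by
  have := (root_facts a ha α hroot hα).1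
  rw [normSq_eq_norm_sq] at this
  nlinarith [norm_nonneg α]

/-- Main rigidity: the remainder sequence is bounded, hence in `{-1,0,1}`. -/
lemma rem_le_one (a : ℤ) (ha : 3 ≤ a) (α : ℂ)
    (hroot : α ^ 3 - (a : ℂ) * α ^ 2 + α - 1 = 0) (hα : α.im ≠ 0)
    (e : ℕ → ℤ) (he : ∀ n, |e n| ≤ a - 1) (R : ℕ → ℤ)
    (hR : ∀ n, R (n + 3) = R n - a * R (n + 1) + R (n + 2) - e n)
    (h0 : |R 0| ≤ 1) (h1 : |R 1| ≤ 1) (h2 : |R 2| ≤ 1)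
    (hs : ∑' n, (e n : ℂ) * α ^ n * α ^ 2 = R 0 * α ^ 2 + (R 2 - R 1) * α + R 1) :
    ∀ n, |R n| ≤ 1 := by
  have hlt := norm_lt a ha α hroot hα
  obtain ⟨hN, ht⟩ := root_facts a ha α hroot hα
  have hα0 : α ≠ 0 := by rintro rfl; simp at hα
  have he' : ∀ n, |(e n : ℝ)| ≤ (a : ℝ) - 1 := fun n => by exact_mod_cast he n
  set T : ℕ → ℂ := fun k => ∑' n, (e (n + k) : ℂ) * α ^ n with hT
  have hTs : ∀ k, T k = e k + α * T (k + 1) := by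
    intro k
    have hsum := summable_bdd α hlt (fun n => e (n + k)) _ (fun n => he' _)
    simp only [hT]
    rw [hsum.tsum_eq_zero_add, ← tsum_mul_left]
    simp only [zero_add, pow_zero, mul_one]
    congr 1
    apply tsum_congr
    intro n
    rw [show n + 1 + k = n + (k + 1) by ring]
    ring
  have hTR : ∀ k, T k * α ^ 2 = R k * α ^ 2 + (R (k + 2) - R (k + 1)) * α + R (k + 1) := by
    intro k
    induction k with
    | zero => rw [tsum_mul_right] at hs; simpa [hT] using hs
    | succ k ih =>
      rw [hTs k] at ih
      apply mul_left_cancel₀ hα0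
      have := hR k
      have h3 : (R (k + 3) : ℂ) = R k - a * R (k + 1) + R (k + 2) - e k := by
        rw [this]; push_cast; ring
      rw [show k + 1 + 2 = k + 3 by ring, show k + 1 + 1 = k + 2 by ring, h3]
      linear_combination ih - (R (k + 1) : ℂ) * hroot
  set D := ((a : ℝ) - 1) * (1 - ‖α‖)⁻¹ with hD
  have hTb : ∀ k, ‖T k‖ ≤ D := fun k => norm_tsum_bdd α hlt (fun n => e (n + k)) _ (fun n => he' _)
  set N := normSq α with hNdef
  have hNpos : 0 < N := normSq_pos.2 hα0
  -- imaginary part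
  have him : ∀ k, (R (k + 2) : ℝ) - N * R (k + 1) = - (T k * α ^ 2 * (starRingEnd ℂ α) ^ 2).im / (α.im * N) := by
    intro k
    rw [hTR k]
    have e1 : (R k * α ^ 2 + (R (k + 2) - R (k + 1)) * α + R (k + 1)) * (starRingEnd ℂ α) ^ 2
        = ((R k * N ^ 2 : ℝ) : ℂ) + ((R (k + 2) - R (k + 1) : ℝ) * N : ℝ) * starRingEnd ℂ α
          + (R (k + 1) : ℝ) * (starRingEnd ℂ α) ^ 2 := by
      have := mul_conj α
      rw [← hNdef] at this
      push_cast
      rw [← this]; ring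
    rw [e1]
    have hne : α.im * N ≠ 0 := mul_ne_zero hα hNpos.ne'
    rw [eq_div_iff hne]
    simp [pow_two, -ofReal_mul, -ofReal_intCast]
    linear_combination (-α.im * R (k + 1)) * ht
  set C := D * N / |α.im| with hC
  have hstep : ∀ k, |(R (k + 2) : ℝ) - N * R (k + 1)| ≤ C := by
    intro k
    rw [him k, abs_div, abs_neg, abs_mul, abs_of_pos hNpos]
    have h5 : |(T k * α ^ 2 * (starRingEnd ℂ α) ^ 2).im| ≤ D * N ^ 2 := by
      refine (abs_im_le_norm _).trans ?_
      rw [mul_assoc, norm_mul, ← mul_pow, mul_conj, ← hNdef]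
      rw [norm_pow, norm_real, Real.norm_of_nonneg hNpos.le]
      gcongr
      exact hTb k
    have h6 : 0 < |α.im| := abs_pos.2 hα
    rw [hC, div_le_div_iff₀ (by positivity) h6]
    calc _ ≤ D * N ^ 2 * |α.im| := by gcongr
      _ = _ := by ring
  have hB : ∀ k, |(R (k + 1) : ℝ)| ≤ 1 + C / (1 - N) := by
    have hC0 : 0 ≤ C := (abs_nonneg _).trans (hstep 0)
    have h1N : 0 < 1 - N := by linarith
    intro k
    induction k with
    | zero =>
      have : |(R 1 : ℝ)| ≤ 1 := by exact_mod_cast h1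
      have : 0 ≤ C / (1 - N) := by positivity
      simp only [zero_add]
      linarith
    | succ k ih =>
      have h7 := hstep k
      rw [show k + 1 + 1 = k + 2 by ring]
      have h8 : |(R (k + 2) : ℝ)| ≤ C + N * |(R (k + 1) : ℝ)| := by
        calc _ = |((R (k + 2) : ℝ) - N * R (k + 1)) + N * R (k + 1)| := by ring_nf
          _ ≤ _ := (abs_add_le _ _).trans (by rw [abs_mul, abs_of_pos hNpos]; linarith)
      have h9 : N * |(R (k + 1) : ℝ)| ≤ N * (1 + C / (1 - N)) := by gcongr
      have h10 : C + N * (C / (1 - N)) = C / (1 - N) := by field_simp; ring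
      nlinarith
  refine abs_le_one a ha R (1 + C / (1 - N)) ?_ ?_ h0 h1 h2
  · intro n
    cases n with
    | zero =>
      have : |(R 0 : ℝ)| ≤ 1 := by exact_mod_cast h0
      have hC0 : 0 ≤ C := (abs_nonneg _).trans (hstep 0)
      have h1N : 0 < 1 - N := by linarith
      have : 0 ≤ C / (1 - N) := by positivity
      linarith
    | succ n => exact hB n
  · intro n
    convert he n using 2
    rw [hR]; ring

lemma rigid (a : ℤ) (ha : 3 ≤ a) (α : ℂ)
    (hroot : α ^ 3 - (a : ℂ) * α ^ 2 + α - 1 = 0) (hα : α.im ≠ 0)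
    (x y : ℤ) (hx : x = 1 ∨ x = -1) (hy : y = 1 ∨ y = -1)
    (c d : ℤ → ℤ) (hc : Admissible a 2 c) (hd : Admissible a 2 d)
    (h : ∑' n : ℕ, (c ((n : ℤ) + 2) : ℂ) * α ^ (n + 2) =
      ∑' n : ℕ, (d ((n : ℤ) + 2) : ℂ) * α ^ (n + 2) + (x * α ^ 2 + (-x - y) * α + y)) :
    2 * ∑' n : ℕ, (c ((n : ℤ) + 2) : ℂ) * α ^ (n + 2) =
      (x * α ^ 2 + (-x - y) * α + y) - (1 + α ^ 2) := by
  have hlt := norm_lt a ha α hroot hα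
  have bd : ∀ c, Admissible a 2 c → ∀ n : ℕ, 0 ≤ c ((n : ℤ) + 2) ∧ c ((n : ℤ) + 2) ≤ a - 1 :=
    fun c hc n => hc.1 _ (by omega)
  have hsum : ∀ c, Admissible a 2 c →
      Summable (fun n : ℕ => (c ((n : ℤ) + 2) : ℂ) * α ^ (n + 2)) := by
    intro c hc
    have := (summable_bdd α hlt (fun n => c ((n : ℤ) + 2)) ((a : ℝ) - 1) (fun n => by
      have := bd c hc n
      have h2 : |c ((n : ℤ) + 2)| ≤ a - 1 := by rw [abs_le]; omega
      exact_mod_cast h2)).mul_right (α ^ 2)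
    refine this.congr (fun n => ?_)
    ring
  set e : ℕ → ℤ := fun n => c ((n : ℤ) + 2) - d ((n : ℤ) + 2) with he
  have heb : ∀ n, |e n| ≤ a - 1 := fun n => by
    have := bd c hc n
    have := bd d hd n
    simp only [he]
    rw [abs_le]; omega
  obtain ⟨R, h0, h1, h2, hR⟩ := exists_seq a e x y (-x)
  have hle := rem_le_one a ha α hroot hα e heb R hR (by rw [h0, abs_le]; omega)
    (by rw [h1, abs_le]; omega) (by rw [h2, abs_le]; omega) (by
      rw [h0, h1, h2]
      have := (hsum c hc).tsum_sub (hsum d hd)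
      push_cast
      rw [h, add_sub_cancel_left] at this
      rw [← this]
      apply tsum_congr
      intro n
      simp only [he]; push_cast; ring)
  have key : ∀ n, (R n = 1 ∨ R n = -1) ∧ (R (n + 1) = 1 ∨ R (n + 1) = -1) ∧ R (n + 2) = - R n := by
    intro n
    induction n with
    | zero => simp only [zero_add]; rw [h0, h1, h2]; exact ⟨hx, hy, rfl⟩
    | succ n ih =>
      obtain ⟨i1, i2, i3⟩ := ih
      have h4 := hR n
      have h5 := abs_le.1 (heb n)
      have h6 := abs_le.1 (hle (n + 3))
      rw [show n + 1 + 2 = n + 3 by ring, show n + 1 + 1 = n + 2 by ring]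
      refine ⟨i2, by omega, ?_⟩
      rcases i2 with i2 | i2 <;> rw [i2] at h4 ⊢ <;> omega
  have hcd : ∀ n : ℕ, c ((n : ℤ) + 2) + d ((n : ℤ) + 2) = a - 1 := by
    intro n
    obtain ⟨i1, i2, i3⟩ := key n
    obtain ⟨j1, j2, j3⟩ := key (n + 1)
    have h4 := hR n
    have b1 := bd c hc n
    have b2 := bd d hd n
    rw [show n + 1 + 2 = n + 3 by ring] at j3
    have h5 : e n = c ((n : ℤ) + 2) - d ((n : ℤ) + 2) := rfl
    rcases i2 with i2 | i2 <;> rw [i2] at h4 j3 <;> omega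
  have hadd := (hsum c hc).tsum_add (hsum d hd)
  have hα1 : (1 : ℂ) - α ≠ 0 := by
    intro h
    have : α = 1 := by linear_combination -h
    rw [this] at hα; simp at hα
  have hg : ∑' n : ℕ, ((c ((n : ℤ) + 2) : ℂ) * α ^ (n + 2) + (d ((n : ℤ) + 2) : ℂ) * α ^ (n + 2))
      = -(1 + α ^ 2) := by
    have : ∀ n : ℕ, (c ((n : ℤ) + 2) : ℂ) * α ^ (n + 2) + (d ((n : ℤ) + 2) : ℂ) * α ^ (n + 2)
        = ((a : ℂ) - 1) * α ^ 2 * α ^ n := by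
      intro n
      have h7 : ((c ((n : ℤ) + 2) : ℂ) + d ((n : ℤ) + 2)) = (a : ℂ) - 1 := by
        exact_mod_cast hcd n
      rw [← h7]; ring
    rw [tsum_congr this, tsum_mul_left, tsum_geometric_of_norm_lt_one hlt]
    field_simp
    linear_combination -hroot
  rw [hg] at hadd
  linear_combination h - hadd

lemma mem_rauzy (a : ℤ) (ha : 3 ≤ a) (α : ℂ)
    (hroot : α ^ 3 - (a : ℂ) * α ^ 2 + α - 1 = 0) (hα : α.im ≠ 0) (j : ℤ) (z : ℂ)
    (hz : z * (1 + α ^ 2) = (if (2 + j) % 4 < 2 then (a : ℂ) - 1 else 0) * α ^ 2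
      + (if (3 + j) % 4 < 2 then (a : ℂ) - 1 else 0) * α ^ 3 - α ^ 2 * (1 + α ^ 2)) :
    z ∈ Rauzy a α := by
  have hlt := norm_lt a ha α hroot hα
  set c : ℤ → ℤ := fun i => if (i + j) % 4 < 2 then a - 1 else 0 with hc
  have hcv : ∀ i, c i = if (i + j) % 4 < 2 then a - 1 else 0 := fun i => rfl
  have hb : ∀ i, 0 ≤ c i ∧ c i ≤ a - 1 := fun i => by
    rw [hcv]; split_ifs <;> omega
  refine ⟨c, ⟨fun i _ => hb i, fun i _ => ?_⟩, ?_⟩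
  · unfold WordLt
    rw [hcv i, hcv (i-1), hcv (i-2), hcv (i-3)]
    split_ifs <;> omega
  have hs : Summable (fun n : ℕ => (c ((n : ℤ) + 2) : ℂ) * α ^ (n + 2)) := by
    have := (summable_bdd α hlt (fun n => c ((n : ℤ) + 2)) ((a : ℝ) - 1) (fun n => by
      have := hb ((n : ℤ) + 2)
      have h2 : |c ((n : ℤ) + 2)| ≤ a - 1 := by rw [abs_le]; omega
      exact_mod_cast h2)).mul_right (α ^ 2)
    refine this.congr (fun n => ?_)
    ring
  have h1 := hs.sum_add_tsum_nat_add 2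
  have hα1 : (1 : ℂ) - α ≠ 0 := by
    intro h
    have : α = 1 := by linear_combination -h
    rw [this] at hα; simp at hα
  have hα2 : (1 : ℂ) + α ^ 2 ≠ 0 := by
    intro h
    have : α ^ 2 = -1 := by linear_combination h
    have h3 := congrArg norm this
    rw [norm_pow, norm_neg, norm_one] at h3
    nlinarith [norm_nonneg α]
  have hadd : ∑' n : ℕ, (c (((n + 2 : ℕ) : ℤ) + 2) : ℂ) * α ^ (n + 2 + 2)
      + α ^ 2 * ∑' n : ℕ, (c ((n : ℤ) + 2) : ℂ) * α ^ (n + 2) = -(α ^ 2 * (1 + α ^ 2)) := by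
    rw [← tsum_mul_left, ← ((summable_nat_add_iff 2).2 hs).tsum_add (hs.mul_left (α ^ 2))]
    have : ∀ n : ℕ, (c (((n + 2 : ℕ) : ℤ) + 2) : ℂ) * α ^ (n + 2 + 2)
        + α ^ 2 * ((c ((n : ℤ) + 2) : ℂ) * α ^ (n + 2)) = ((a : ℂ) - 1) * α ^ 4 * α ^ n := by
      intro n
      have h7 : c (((n + 2 : ℕ) : ℤ) + 2) + c ((n : ℤ) + 2) = a - 1 := by
        rw [hcv, hcv]; push_cast; split_ifs <;> omega
      have h8 : (c (((n + 2 : ℕ) : ℤ) + 2) : ℂ) + c ((n : ℤ) + 2) = (a : ℂ) - 1 := by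
        exact_mod_cast h7
      rw [← h8]; ring
    rw [tsum_congr this, tsum_mul_left, tsum_geometric_of_norm_lt_one hlt]
    field_simp
    linear_combination -α ^ 2 * hroot
  have c2 : (c 2 : ℂ) = if (2 + j) % 4 < 2 then (a : ℂ) - 1 else 0 := by
    rw [hcv]; split_ifs <;> simp
  have c3 : (c 3 : ℂ) = if (3 + j) % 4 < 2 then (a : ℂ) - 1 else 0 := by
    rw [hcv]; split_ifs <;> simp
  rw [← c2, ← c3] at hz
  simp only [Finset.sum_range_succ, Finset.sum_range_zero, Nat.cast_zero, Nat.cast_one, zero_add,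
    Int.reduceAdd, Nat.reduceAdd] at h1
  apply mul_right_cancel₀ hα2
  linear_combination hz - hadd + h1

theorem rauzy_inter_singletons (a : ℤ) (ha : 3 ≤ a) (α : ℂ)
    (hroot : α ^ 3 - (a : ℂ) * α ^ 2 + α - 1 = 0) (hα : α.im ≠ 0) :
    Rauzy a α ∩ ((· + (α ^ 2 - 1)) '' Rauzy a α) = {-1} ∧
    Rauzy a α ∩ ((· + (α - 1) ^ 2) '' Rauzy a α) = {-α} := by
  constructor
  · apply Set.eq_singleton_iff_unique_mem.2
    refine ⟨⟨?_, -α ^ 2, ?_, by ring⟩, ?_⟩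
    · apply mem_rauzy a ha α hroot hα 2
      norm_num
      linear_combination (1 + α) * hroot
    · apply mem_rauzy a ha α hroot hα 0
      norm_num
    · rintro z ⟨⟨c, hc, hz⟩, w, ⟨d, hd, hw⟩, hzw⟩
      have := rigid a ha α hroot hα 1 (-1) (by simp) (by simp) c d hc hd (by
        rw [← hz, ← hw, ← hzw]; push_cast; ring)
      rw [← hz] at this
      push_cast at this
      linear_combination this / 2
  · apply Set.eq_singleton_iff_unique_mem.2
    refine ⟨⟨?_, -α - (α - 1) ^ 2, ?_, by ring⟩, ?_⟩
    · apply mem_rauzy a ha α hroot hα 1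
      norm_num
      linear_combination α * hroot
    · apply mem_rauzy a ha α hroot hα 3
      norm_num
      linear_combination hroot
    · rintro z ⟨⟨c, hc, hz⟩, w, ⟨d, hd, hw⟩, hzw⟩
      have := rigid a ha α hroot hα 1 1 (by simp) (by simp) c d hc hd (by
        rw [← hz, ← hw, ← hzw]; push_cast; ring)
      rw [← hz] at this
      push_cast at this
      linear_combination this / 2
end
end

section
/- The intersection B_{α²-α} ∩ B_{1-α} is the singleton { -α }. -/
open Complex Filter Topology

noncomputable section

/-- Basic facts on `α`: with `β = a - 2 Re α` we have `β > 1` and `|α| < 1`. -/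
theorem alpha_basic (a : ℤ) (ha : 3 ≤ a) (α : ℂ)
    (hroot : α ^ 3 - (a : ℂ) * α ^ 2 + α - 1 = 0) (hα : α.im ≠ 0) :
    1 < (a : ℝ) - 2 * α.re ∧ ‖α‖ < 1 := by
  have ha' : (3 : ℝ) ≤ a := by exact_mod_cast ha
  have hre := congrArg Complex.re hroot
  have him := congrArg Complex.im hroot
  simp [pow_succ] at hre him
  set x := α.re
  set y := α.im
  set A : ℝ := (a : ℝ)
  have hy : y ^ 2 = 3 * x ^ 2 - 2 * A * x + 1 := by
    have : y * (y ^ 2 - (3 * x ^ 2 - 2 * A * x + 1)) = 0 := by linear_combination -him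
    rcases mul_eq_zero.1 this with h | h
    · exact absurd h hα
    · linarith
  have hN : (A - 2 * x) * (x ^ 2 + y ^ 2) = 1 := by
    linear_combination hre + (2 * x) * hy - (2 * x - 0) * hy + (0 : ℝ) * hy
      + (x) * hy
  have hβ : (A - 2 * x) ^ 3 - A * (A - 2 * x) ^ 2 + (A - 2 * x) - 1 = 0 := by
    linear_combination hN - (A - 2 * x) * hy
  have h1 : 1 < A - 2 * x := by
    by_contra hcon
    push Not at hcon
    set b := A - 2 * x
    have h2 : 0 < b := by
      by_contra h
      nlinarith [sq_nonneg x, sq_nonneg y]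
    nlinarith [mul_pos h2 h2]
  refine ⟨h1, ?_⟩
  have h3 : x ^ 2 + y ^ 2 < 1 := by nlinarith [sq_nonneg x, sq_nonneg y]
  have h4 : ‖α‖ ^ 2 < 1 := by
    rw [Complex.sq_norm, Complex.normSq_apply]
    nlinarith
  nlinarith [norm_nonneg α]

theorem summable_digits (α : ℂ) (hα : ‖α‖ < 1) (δ : ℕ → ℤ) (K : ℝ)
    (hδ : ∀ n, |(δ n : ℝ)| ≤ K) : Summable (fun n => (δ n : ℂ) * α ^ n) := by
  refine Summable.of_norm_bounded
    ((summable_geometric_of_lt_one (norm_nonneg α) hα).mul_left K) (fun n => ?_)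
  rw [norm_mul, norm_pow]
  gcongr
  rw [Complex.norm_intCast]
  exact hδ n

/-- Formal quotient of the power series `δ` by `1 - X + a X² - X³` (shifted by 3). -/
def wseq (a : ℤ) (δ : ℕ → ℤ) : ℕ → ℤ
  | 0 => 0
  | 1 => 0
  | 2 => 0
  | n + 3 => δ n + wseq a δ (n + 2) - a * wseq a δ (n + 1) + wseq a δ n

/-- The quotient of a bounded series vanishing at `α` is bounded. -/
theorem quot_bounded (a : ℤ) (ha : 3 ≤ a) (α : ℂ)
    (hroot : α ^ 3 - (a : ℂ) * α ^ 2 + α - 1 = 0) (hα : α.im ≠ 0)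
    (δ W : ℕ → ℤ) (hδ : ∀ n, |δ n| ≤ a - 1)
    (hsum : HasSum (fun n => (δ n : ℂ) * α ^ n) 0)
    (h0 : W 0 = 0) (h1 : W 1 = 0) (h2 : W 2 = 0)
    (hW : ∀ n, W (n + 3) = δ n + W (n + 2) - a * W (n + 1) + W n) :
    ∃ M : ℕ, ∀ n, |W n| ≤ M := by
  obtain ⟨hβ, hn⟩ := alpha_basic a ha α hroot hα
  have hα0 : α ≠ 0 := by rintro rfl; simp at hα
  set β : ℝ := (a : ℝ) - 2 * α.re with hβdef
  have hδ' : ∀ n, |(δ n : ℝ)| ≤ (a : ℝ) - 1 := fun n => by exact_mod_cast hδ n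
  have hfin : ∀ N, ∑ n ∈ Finset.range N, (δ n : ℂ) * α ^ n =
      α ^ N * (((W (N + 2) + W N - a * W (N + 1) : ℤ) : ℂ)
        + ((W (N + 1) - a * W (N + 2) : ℤ) : ℂ) * α + ((W (N + 2) : ℤ) : ℂ) * α ^ 2) := by
    intro N
    induction N with
    | zero => simp [h0, h1, h2]
    | succ N ih =>
      rw [Finset.sum_range_succ, ih, show N + 1 + 2 = N + 3 from rfl,
        show N + 1 + 1 = N + 2 from rfl, hW N]
      push_cast
      linear_combination (-(α ^ N) * ((δ N : ℂ) + W (N + 2) - a * W (N + 1) + W N)) * hroot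
  set L : ℝ := ((a : ℝ) - 1) * (1 - ‖α‖)⁻¹
  have hs : ∀ N, ‖((W (N + 2) + W N - a * W (N + 1) : ℤ) : ℂ)
        + ((W (N + 1) - a * W (N + 2) : ℤ) : ℂ) * α + ((W (N + 2) : ℤ) : ℂ) * α ^ 2‖ ≤ L := by
    intro N
    have e1 := hsum.summable.sum_add_tsum_nat_add N
    rw [hsum.tsum_eq, hfin N] at e1
    have e2 : ∑' i, (δ (i + N) : ℂ) * α ^ (i + N) =
        α ^ N * ∑' i, (δ (i + N) : ℂ) * α ^ i := by
      rw [← tsum_mul_left]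
      congr 1; ext i; ring
    rw [e2, ← mul_add] at e1
    have e3 := (mul_eq_zero.1 e1).resolve_left (pow_ne_zero _ hα0)
    rw [eq_neg_of_add_eq_zero_left e3, norm_neg]
    refine tsum_of_norm_bounded
      ((hasSum_geometric_of_lt_one (norm_nonneg α) hn).mul_left ((a : ℝ) - 1)) (fun i => ?_)
    rw [norm_mul, norm_pow]
    gcongr
    rw [Complex.norm_intCast]
    exact hδ' _
  set K : ℝ := L / |α.im|
  have hK : ∀ N, |(W (N + 1) : ℝ) - β * W (N + 2)| ≤ K := by
    intro N
    have e1 := (Complex.abs_im_le_norm _).trans (hs N)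
    rw [le_div_iff₀ (abs_pos.2 hα), ← abs_mul]
    refine le_of_eq_of_le ?_ e1
    congr 1
    simp [pow_succ, hβdef]
    ring
  have hK0 : 0 ≤ K := (abs_nonneg _).trans (hK 0)
  have hb : ∀ n, |(W (n + 1) : ℝ)| ≤ K / (β - 1) := by
    intro n
    induction n with
    | zero => simp [h1]; exact div_nonneg hK0 (by linarith)
    | succ n ih =>
      have hk := hK n
      have hb1 : 0 < β - 1 := by linarith
      rw [le_div_iff₀ hb1] at ih ⊢
      have e : β * |(W (n + 2) : ℝ)| ≤ K + |(W (n + 1) : ℝ)| := by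
        have : β * |(W (n + 2) : ℝ)| = |β * W (n + 2)| := by
          rw [abs_mul, abs_of_pos (show 0 < β by linarith)]
        rw [this]
        have := abs_sub_abs_le_abs_sub (β * W (n + 2) : ℝ) (W (n + 1))
        rw [abs_sub_comm] at this
        linarith
      change |(W (n + 2) : ℝ)| * (β - 1) ≤ K
      by_contra hcon
      push Not at hcon
      nlinarith [abs_nonneg (W (n + 2) : ℝ), abs_nonneg (W (n + 1) : ℝ)]
  obtain ⟨M, hM⟩ := exists_nat_ge (K / (β - 1))
  refine ⟨M, fun n => ?_⟩
  cases n with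
  | zero => simp [h0]
  | succ n =>
    have := (hb n).trans hM
    exact_mod_cast this

/-- A bounded two-sided integer sequence with small image under `1 - X + a X² - X³`
is bounded by one. -/
theorem le_one_of_bounded (a : ℤ) (ha : 3 ≤ a) (W : ℤ → ℤ)
    (hW : ∀ n, |W (n + 1) - W n + a * W (n - 1) - W (n - 2)| ≤ a - 1)
    (M : ℕ) (hM : ∀ n, |W n| ≤ M) : ∀ n, |W n| ≤ 1 := by
  induction M with
  | zero => intro n; have := hM n; push_cast at this; omega
  | succ M ih =>
    rcases Nat.eq_zero_or_pos M with h0 | hpos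
    · subst h0; simpa using hM
    apply ih
    intro n
    push_cast at hM
    have hM2 : (1 : ℤ) ≤ M := by exact_mod_cast hpos
    simp only [abs_le] at hM hW ⊢
    by_cases h6 : 6 ≤ a
    · have r := hW (n + 1)
      have b1 := hM n
      have b2 := hM (n + 1)
      have b3 := hM (n + 2)
      have b4 := hM (n - 1)
      rw [show n + 1 + 1 = n + 2 by ring, show n + 1 - 1 = n by ring,
        show n + 1 - 2 = n - 1 by ring] at r
      constructor
      · by_contra hcon
        have : W n = -(M + 1) := by omega
        rw [this] at r
        nlinarith
      · by_contra hcon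
        have : W n = M + 1 := by omega
        rw [this] at r
        nlinarith
    · have key : ∀ k : ℤ, -(a - 1) ≤ W (n + (k + 1)) - W (n + k) + a * W (n + (k - 1))
          - W (n + (k - 2)) ∧ W (n + (k + 1)) - W (n + k) + a * W (n + (k - 1))
          - W (n + (k - 2)) ≤ a - 1 := by
        intro k
        have := hW (n + k)
        rw [show n + k + 1 = n + (k + 1) by ring, show n + k - 1 = n + (k - 1) by ring,
          show n + k - 2 = n + (k - 2) by ring] at this
        exact this
      have k1 := key (-3)
      have k2 := key (-2)
      have k3 := key (-1)
      have k4 := key 0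
      have k5 := key 1
      have k6 := key 2
      have k7 := key 3
      have k8 := key 4
      have k9 := key 5
      have k10 := key 6
      have m (k : ℤ) := hM (n + k)
      have m1 := m (-5)
      have m2 := m (-4)
      have m3 := m (-3)
      have m4 := m (-2)
      have m5 := m (-1)
      have m6 := m 0
      have m7 := m 1
      have m8 := m 2
      have m9 := m 3
      have m10 := m 4
      have m11 := m 5
      have m12 := m 6
      have m13 := m 7
      clear key m ih hW hM
      norm_num at *
      have h5 : a = 3 ∨ a = 4 ∨ a = 5 := by omega
      rcases h5 with rfl | rfl | rfl <;> constructor <;> by_contra hcon <;> push Not at hcon <;>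
        linarith

theorem wseq_le_one (a : ℤ) (ha : 3 ≤ a) (α : ℂ)
    (hroot : α ^ 3 - (a : ℂ) * α ^ 2 + α - 1 = 0) (hα : α.im ≠ 0)
    (δ W : ℕ → ℤ) (hδ : ∀ n, |δ n| ≤ a - 1)
    (hsum : HasSum (fun n => (δ n : ℂ) * α ^ n) 0)
    (h0 : W 0 = 0) (h1 : W 1 = 0) (h2 : W 2 = 0)
    (hW : ∀ n, W (n + 3) = δ n + W (n + 2) - a * W (n + 1) + W n) :
    ∀ n, |W n| ≤ 1 := by
  obtain ⟨M, hM⟩ := quot_bounded a ha α hroot hα δ W hδ hsum h0 h1 h2 hW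
  have hz : ∀ n : ℤ, n ≤ 2 → W n.toNat = 0 := by
    intro n hn
    have : n.toNat = 0 ∨ n.toNat = 1 ∨ n.toNat = 2 := by omega
    rcases this with h | h | h <;> rw [h] <;> assumption
  have := le_one_of_bounded a ha (fun n => W n.toNat) (fun n => ?_) M (fun n => hM _)
  · intro n; simpa using this n
  · by_cases hn : n ≤ 1
    · beta_reduce
      rw [hz _ (by omega), hz _ (by omega), hz _ (by omega), hz _ (by omega)]
      simp; omega
    · obtain ⟨m, rfl⟩ : ∃ m : ℕ, n = m + 2 := ⟨(n - 2).toNat, by omega⟩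
      have e1 : ((m : ℤ) + 2 + 1).toNat = m + 3 := by omega
      have e2 : ((m : ℤ) + 2).toNat = m + 2 := by omega
      have e3 : ((m : ℤ) + 2 - 1).toNat = m + 1 := by omega
      have e4 : ((m : ℤ) + 2 - 2).toNat = m := by omega
      simp only [e1, e2, e3, e4, hW m]
      have := hδ m
      convert this using 2
      ring

/-- The periodic digit sequence with digits `a-1` at positions `r, r+1` mod 4. -/
def pat (a r : ℤ) (i : ℤ) : ℤ := if (i - r) % 4 ≤ 1 then a - 1 else 0

theorem pat_adm (a : ℤ) (ha : 3 ≤ a) (r k : ℤ) : Admissible a k (pat a r) := by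
  constructor
  · intro i _
    unfold pat
    split_ifs <;> omega
  · intro i _
    unfold WordLt pat
    split_ifs <;> omega

theorem pat_abs (a : ℤ) (ha : 3 ≤ a) (r i : ℤ) : |pat a r i| ≤ a - 1 := by
  unfold pat
  rw [abs_le]
  split_ifs <;> omega

theorem digits_summable (a : ℤ) (α : ℂ) (hn : ‖α‖ < 1) (c : ℤ → ℤ) (hc : Admissible a 2 c) :
    Summable (fun n : ℕ => (c ((n : ℤ) + 2) : ℂ) * α ^ (n + 2)) := by
  have h := summable_digits α hn (fun n : ℕ => c ((n : ℤ) + 2)) ((a : ℝ) - 1) (fun n => by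
    have := hc.1 ((n : ℤ) + 2) (by omega)
    have h : |c ((n : ℤ) + 2)| ≤ a - 1 := by rw [abs_le]; omega
    exact_mod_cast h)
  refine (h.mul_left (α ^ 2)).congr (fun n => ?_)
  ring

theorem pat_tsum (a : ℤ) (ha : 3 ≤ a) (α : ℂ) (hn : ‖α‖ < 1) (r : ℤ) (v : ℂ)
    (hv : (pat a r 2 : ℂ) * α ^ 2 + (pat a r 3 : ℂ) * α ^ 3 + (pat a r 4 : ℂ) * α ^ 4
      + (pat a r 5 : ℂ) * α ^ 5 = v * (1 - α ^ 4)) :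
    ∑' n : ℕ, (pat a r ((n : ℤ) + 2) : ℂ) * α ^ (n + 2) = v := by
  have hs := digits_summable a α hn _ (pat_adm a ha r 2)
  have h := hs.sum_add_tsum_nat_add 4
  have e : ∑' n : ℕ, (pat a r (((n + 4 : ℕ) : ℤ) + 2) : ℂ) * α ^ (n + 4 + 2) =
      α ^ 4 * ∑' n : ℕ, (pat a r ((n : ℤ) + 2) : ℂ) * α ^ (n + 2) := by
    rw [← tsum_mul_left]
    congr 1; ext n
    have : pat a r (((n + 4 : ℕ) : ℤ) + 2) = pat a r ((n : ℤ) + 2) := by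
      unfold pat
      have : (((n + 4 : ℕ) : ℤ) + 2 - r) % 4 = ((n : ℤ) + 2 - r) % 4 := by push_cast; omega
      rw [this]
    rw [this]; ring
  rw [e] at h
  simp only [Finset.sum_range_succ, Finset.sum_range_zero] at h
  norm_num at h
  have h4 : (1 - α ^ 4) ≠ 0 := by
    intro h0
    have h1 : α ^ 4 = 1 := by linear_combination -h0
    have h2 : ‖α‖ ^ 4 = 1 := by rw [← norm_pow, h1]; simp
    have := pow_lt_one₀ (norm_nonneg α) hn (n := 4) (by norm_num)
    linarith
  apply mul_right_cancel₀ h4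
  linear_combination -h + hv

/-- Prefix four digits to a sequence. -/
def pre (p q r s : ℤ) (f : ℕ → ℤ) : ℕ → ℤ
  | 0 => p
  | 1 => q
  | 2 => r
  | 3 => s
  | n + 4 => f n

theorem pre_hasSum (α : ℂ) (p q r s : ℤ) (f : ℕ → ℤ) (v : ℂ)
    (h : HasSum (fun n => (f n : ℂ) * α ^ (n + 2)) v)
    (hv : (p : ℂ) + q * α + r * α ^ 2 + s * α ^ 3 + α ^ 2 * v = 0) :
    HasSum (fun n => (pre p q r s f n : ℂ) * α ^ n) 0 := by
  rw [← hasSum_nat_add_iff' 4]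
  have e1 : (fun n => (pre p q r s f (n + 4) : ℂ) * α ^ (n + 4)) =
      fun n => α ^ 2 * ((f n : ℂ) * α ^ (n + 2)) := by
    funext n
    simp only [pre]; ring
  have e2 : 0 - ∑ i ∈ Finset.range 4, (pre p q r s f i : ℂ) * α ^ i = α ^ 2 * v := by
    simp [Finset.sum_range_succ, pre]
    linear_combination -hv
  rw [e1, e2]
  exact h.mul_left (α ^ 2)

/-- The digits of the common expansion are forced. -/
theorem forced (a : ℤ) (ha : 3 ≤ a) (c d e : ℕ → ℤ) (W V : ℕ → ℤ)
    (hc : ∀ n, 0 ≤ c n ∧ c n ≤ a - 1) (hd : ∀ n, 0 ≤ d n ∧ d n ≤ a - 1)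
    (he : ∀ n, 0 ≤ e n ∧ e n ≤ a - 1)
    (hW1 : ∀ n, |W n| ≤ 1) (hV1 : ∀ n, |V n| ≤ 1) (hD : ∀ n, |V n - W n| ≤ 1)
    (hW : ∀ n, W (n + 3) = (d n - c n) + W (n + 2) - a * W (n + 1) + W n)
    (hV : ∀ n, V (n + 3) = (e n - c n) + V (n + 2) - a * V (n + 1) + V n)
    (w0 : W 0 = 1) (w1 : W 1 = 0) (w2 : W 2 = -1)
    (v0 : V 0 = 0) (v1 : V 1 = 1) (v2 : V 2 = 0) :
    ∀ n, c n = pat a 3 ((n : ℤ) + 2) := by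
  simp only [abs_le] at hW1 hV1 hD
  have main : ∀ k : ℕ, (W (4 * k) = 1 ∧ W (4 * k + 1) = 0 ∧ W (4 * k + 2) = -1 ∧
      V (4 * k) = 0 ∧ V (4 * k + 1) = 1 ∧ V (4 * k + 2) = 0) →
      (W (4 * k + 4) = 1 ∧ W (4 * k + 5) = 0 ∧ W (4 * k + 6) = -1 ∧
      V (4 * k + 4) = 0 ∧ V (4 * k + 5) = 1 ∧ V (4 * k + 6) = 0) ∧
      c (4 * k) = 0 ∧ c (4 * k + 1) = a - 1 ∧ c (4 * k + 2) = a - 1 ∧ c (4 * k + 3) = 0 := by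
    rintro k
    generalize 4 * k = m
    rintro ⟨a0, a1, a2, b0, b1, b2⟩
    have step0 : W (m + 3) = 0 ∧ V (m + 3) = -1 ∧ c m = 0 := by
      have p := hW m
      have q := hV m
      rw [a0, a1, a2] at p
      rw [b0, b1, b2] at q
      have := hW1 (m + 3); have := hV1 (m + 3); have := hD (m + 3)
      have := hc m; have := hd m; have := he m
      omega
    obtain ⟨a3, b3, c0⟩ := step0
    have step1 : W (m + 4) = 1 ∧ V (m + 4) = 0 ∧ c (m + 1) = a - 1 := by
      have p := hW (m + 1)
      have q := hV (m + 1)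
      simp only [add_assoc, Nat.reduceAdd] at p q
      rw [a1, a2, a3] at p
      rw [b1, b2, b3] at q
      have := hW1 (m + 4); have := hV1 (m + 4); have := hD (m + 4)
      have := hc (m + 1); have := hd (m + 1); have := he (m + 1)
      omega
    obtain ⟨a4, b4, c1⟩ := step1
    have step2 : W (m + 5) = 0 ∧ V (m + 5) = 1 ∧ c (m + 2) = a - 1 := by
      have p := hW (m + 2)
      have q := hV (m + 2)
      simp only [add_assoc, Nat.reduceAdd] at p q
      rw [a2, a3, a4] at p
      rw [b2, b3, b4] at q
      have := hW1 (m + 5); have := hV1 (m + 5); have := hD (m + 5)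
      have := hc (m + 2); have := hd (m + 2); have := he (m + 2)
      omega
    obtain ⟨a5, b5, c2⟩ := step2
    have step3 : W (m + 6) = -1 ∧ V (m + 6) = 0 ∧ c (m + 3) = 0 := by
      have p := hW (m + 3)
      have q := hV (m + 3)
      simp only [add_assoc, Nat.reduceAdd] at p q
      rw [a3, a4, a5] at p
      rw [b3, b4, b5] at q
      have := hW1 (m + 6); have := hV1 (m + 6); have := hD (m + 6)
      have := hc (m + 3); have := hd (m + 3); have := he (m + 3)
      omega
    obtain ⟨a6, b6, c3⟩ := step3
    exact ⟨⟨a4, a5, a6, b4, b5, b6⟩, c0, c1, c2, c3⟩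
  have st : ∀ k : ℕ, (W (4 * k) = 1 ∧ W (4 * k + 1) = 0 ∧ W (4 * k + 2) = -1 ∧
      V (4 * k) = 0 ∧ V (4 * k + 1) = 1 ∧ V (4 * k + 2) = 0) := by
    intro k
    induction k with
    | zero => exact ⟨w0, w1, w2, v0, v1, v2⟩
    | succ k ih => exact (main k ih).1
  intro n
  obtain ⟨-, c0, c1, c2, c3⟩ := main (n / 4) (st _)
  unfold pat
  have hn : n = 4 * (n / 4) ∨ n = 4 * (n / 4) + 1 ∨ n = 4 * (n / 4) + 2 ∨
    n = 4 * (n / 4) + 3 := by omega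
  rcases hn with h | h | h | h
  · rw [if_neg (by omega), h, c0]
  · rw [if_pos (by omega), h, c1]
  · rw [if_pos (by omega), h, c2]
  · rw [if_neg (by omega), h, c3]

theorem bset_inter_2 (a : ℤ) (ha : 3 ≤ a) (α : ℂ)
    (hroot : α ^ 3 - (a : ℂ) * α ^ 2 + α - 1 = 0) (hα : α.im ≠ 0) :
    BSet a α (α ^ 2 - α) ∩ BSet a α (1 - α) = {-α} := by
  obtain ⟨hβ, hn⟩ := alpha_basic a ha α hroot hα
  have hc3 : ∑' n : ℕ, (pat a 3 ((n : ℤ) + 2) : ℂ) * α ^ (n + 2) = -α := by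
    apply pat_tsum a ha α hn
    norm_num [pat]
    linear_combination (-α - α ^ 2) * hroot
  have hc4 : ∑' n : ℕ, (pat a 4 ((n : ℤ) + 2) : ℂ) * α ^ (n + 2) = -α ^ 2 := by
    apply pat_tsum a ha α hn
    norm_num [pat]
    linear_combination (-α ^ 2 - α ^ 3) * hroot
  have hc2 : ∑' n : ℕ, (pat a 2 ((n : ℤ) + 2) : ℂ) * α ^ (n + 2) = -1 := by
    apply pat_tsum a ha α hn
    norm_num [pat]
    linear_combination (-1 - α) * hroot
  ext z
  simp only [Set.mem_singleton_iff]
  constructor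
  · rintro ⟨⟨⟨c, hc, hz⟩, ⟨y, ⟨d, hd, hy⟩, hyz⟩⟩, ⟨-, ⟨x, ⟨e, he, hx⟩, hxz⟩⟩⟩
    simp only at hyz hxz
    have sc := digits_summable a α hn c hc
    have sd := digits_summable a α hn d hd
    have se := digits_summable a α hn e he
    have Hc := sc.hasSum
    have Hd := sd.hasSum
    have He := se.hasSum
    rw [← hz] at Hc
    rw [← hy] at Hd
    rw [← hx] at He
    have dig : ∀ f : ℤ → ℤ, Admissible a 2 f → ∀ n : ℕ, 0 ≤ f ((n : ℤ) + 2) ∧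
        f ((n : ℤ) + 2) ≤ a - 1 := fun f hf n => hf.1 _ (by omega)
    have Dc := dig c hc
    have Dd := dig d hd
    have De := dig e he
    set δ := pre 1 0 (a - 1) (a - 2) (fun n => d ((n : ℤ) + 2) - c ((n : ℤ) + 2)) with hδ
    set ε := pre 0 0 1 (-1) (fun n => e ((n : ℤ) + 2) - c ((n : ℤ) + 2)) with hε
    have Sδ : HasSum (fun n => (δ n : ℂ) * α ^ n) 0 := by
      apply pre_hasSum α _ _ _ _ _ (y - z)
      · have e1 : (fun n : ℕ => ((d ((n : ℤ) + 2) - c ((n : ℤ) + 2) : ℤ) : ℂ) * α ^ (n + 2)) =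
            fun n : ℕ => (d ((n : ℤ) + 2) : ℂ) * α ^ (n + 2) -
              (c ((n : ℤ) + 2) : ℂ) * α ^ (n + 2) := by
          funext n
          push_cast; ring
        rw [e1]
        exact Hd.sub Hc
      · rw [← hyz]; push_cast
        linear_combination (-1 - α) * hroot
    have Sε : HasSum (fun n => (ε n : ℂ) * α ^ n) 0 := by
      apply pre_hasSum α _ _ _ _ _ (x - z)
      · have e1 : (fun n : ℕ => ((e ((n : ℤ) + 2) - c ((n : ℤ) + 2) : ℤ) : ℂ) * α ^ (n + 2)) =
            fun n : ℕ => (e ((n : ℤ) + 2) : ℂ) * α ^ (n + 2) -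
              (c ((n : ℤ) + 2) : ℂ) * α ^ (n + 2) := by
          funext n
          push_cast; ring
        rw [e1]
        exact He.sub Hc
      · rw [← hxz]; push_cast
        ring
    have Bδ : ∀ n, |δ n| ≤ a - 1 := by
      intro n
      rw [abs_le]
      match n with
      | 0 => simp [hδ, pre]; omega
      | 1 => simp [hδ, pre]; omega
      | 2 => simp [hδ, pre]; omega
      | 3 => simp [hδ, pre]; omega
      | n + 4 =>
        have := Dc n; have := Dd n
        simp only [hδ, pre]; omega
    have Bε : ∀ n, |ε n| ≤ a - 1 := by
      intro n
      rw [abs_le]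
      match n with
      | 0 => simp [hε, pre]; omega
      | 1 => simp [hε, pre]; omega
      | 2 => simp [hε, pre]; omega
      | 3 => simp [hε, pre]; omega
      | n + 4 =>
        have := Dc n; have := De n
        simp only [hε, pre]; omega
    have Bdiff : ∀ n, |ε n - δ n| ≤ a - 1 := by
      intro n
      rw [abs_le]
      match n with
      | 0 => simp [hδ, hε, pre]; omega
      | 1 => simp [hδ, hε, pre]; omega
      | 2 => simp [hδ, hε, pre]; omega
      | 3 => simp [hδ, hε, pre]; omega
      | n + 4 =>
        have := Dd n; have := De n
        simp only [hδ, hε, pre]; omega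
    have W1 := wseq_le_one a ha α hroot hα δ (wseq a δ) Bδ Sδ rfl rfl rfl (fun n => rfl)
    have V1 := wseq_le_one a ha α hroot hα ε (wseq a ε) Bε Sε rfl rfl rfl (fun n => rfl)
    have D1 := wseq_le_one a ha α hroot hα (fun n => ε n - δ n)
      (fun n => wseq a ε n - wseq a δ n) Bdiff (by
        have e1 : (fun n => ((ε n - δ n : ℤ) : ℂ) * α ^ n) =
            fun n => (ε n : ℂ) * α ^ n - (δ n : ℂ) * α ^ n := by
          funext n
          push_cast; ring
        rw [e1]
        simpa using Sε.sub Sδ) rfl rfl rfl (fun n => by simp only [wseq]; ring)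
    have F := forced a ha (fun n => c ((n : ℤ) + 2)) (fun n => d ((n : ℤ) + 2))
      (fun n => e ((n : ℤ) + 2)) (fun n => wseq a δ (n + 4)) (fun n => wseq a ε (n + 4))
      Dc Dd De (fun n => W1 _) (fun n => V1 _) (fun n => D1 _)
      (fun n => rfl) (fun n => rfl)
      (by simp [wseq, hδ, pre]) (by simp [wseq, hδ, pre]) (by simp [wseq, hδ, pre])
      (by simp [wseq, hε, pre]) (by simp [wseq, hε, pre]) (by simp [wseq, hε, pre])
    rw [hz, ← hc3]
    congr 1; ext n
    rw [← F n]
  · rintro rfl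
    have hm : -α ∈ Rauzy a α := ⟨pat a 3, pat_adm a ha _ _, hc3.symm⟩
    refine ⟨⟨hm, ⟨-α ^ 2, ⟨pat a 4, pat_adm a ha _ _, hc4.symm⟩, ?_⟩⟩,
      ⟨hm, ⟨-1, ⟨pat a 2, pat_adm a ha _ _, hc2.symm⟩, ?_⟩⟩⟩
    · simp only; ring
    · simp only; ring
end
end
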